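/- Let k ≥ 1 and P ∈ ℂ[X] of degree ≤ 2k. For every irrational real number x with x > 0: if x > 1 then P^Γ(x) − x^{2k} P^Γ(1/x) = −P(x), and if 0 < x < 1 then P^Γ(x) − x^{2k} P^Γ(1/x) = x^{2k} P(1/x). Equivalently, (P^Γ|(1−ε))(x) = χ_{(0,1)}(x) · (P|(1+ε))(x) − P(x) for irrational x > 0. -/

import Mathlib

open Polynomial Matrix

noncomputable section

abbrev Mat2 := Matrix (Fin 2) (Fin 2) ℤ

/-- The matrix `Tⁿ = [[1,n],[0,1]]`. -/
def Tpow (n : ℤ) : Mat2 := !![1, n; 0, 1]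

/-- The matrix `ε = [[0,1],[1,0]]`. -/
def Meps : Mat2 := !![0, 1; 1, 0]

/-- The matrix `S = [[0,-1],[1,0]]`. -/
def MS : Mat2 := !![0, -1; 1, 0]

/-- The matrix `T = [[1,1],[0,1]]`. -/
def MT : Mat2 := !![1, 1; 0, 1]

/-- The matrix `σ = [[-1,0],[0,1]]`. -/
def Msig : Mat2 := !![-1, 0; 0, 1]

/-- The matrix `U = TS = [[1,-1],[1,0]]`. -/
def MU : Mat2 := MT * MS

/-- Möbius action of an integer matrix on a real number. -/
def moeb (M : Mat2) (x : ℝ) : ℝ :=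
  ((M 0 0 : ℝ) * x + (M 0 1 : ℝ)) / ((M 1 0 : ℝ) * x + (M 1 1 : ℝ))

/-- The sequence `x_i` of the (positive) continued fraction algorithm:
`x_0 = x`, `x_{i+1} = 1/(x_i - ⌊x_i⌋)`. -/
def cfX (x : ℝ) : ℕ → ℝ
  | 0 => x
  | i + 1 => 1 / (cfX x i - (⌊cfX x i⌋ : ℝ))

/-- The partial quotients `n_i = ⌊x_i⌋` of the continued fraction of `x`. -/
def cfN (x : ℝ) (i : ℕ) : ℤ := ⌊cfX x i⌋

/-- The matrices `γ_0 = Id`, `γ_{i+1} = ε T^{-n_i} γ_i`. -/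
def gam (x : ℝ) : ℕ → Mat2
  | 0 => 1
  | i + 1 => (Meps * Tpow (-(cfN x i))) * gam x i

/-- `Γ(x) = {γ_1, γ_2, γ_3, …}`. -/
def GammaSet (x : ℝ) : Set Mat2 := {M | ∃ i, 1 ≤ i ∧ M = gam x i}

/-- The matrices `γ'_0 = Id`, `γ'_{i+1} = Tγ'_i` if `γ'_i(x) ≤ 0`,
`T^{-1}εγ'_i` if `0 < γ'_i(x) ≤ 1`, and `T^{-1}γ'_i` if `γ'_i(x) > 1`. -/
def gam' (x : ℝ) : ℕ → Mat2
  | 0 => 1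
  | i + 1 =>
    if moeb (gam' x i) x ≤ 0 then MT * gam' x i
    else if moeb (gam' x i) x ≤ 1 then (Tpow (-1) * Meps) * gam' x i
    else Tpow (-1) * gam' x i

/-- `Γ(x)' = {γ'_1, γ'_2, γ'_3, …}`. -/
def GammaSet' (x : ℝ) : Set Mat2 := {M | ∃ i, 1 ≤ i ∧ M = gam' x i}

/-- The sequence `x_i` of the negative continued fraction algorithm:
`x_0 = x`, `x_{i+1} = 1/(⌈x_i⌉ - x_i)`. -/
def ncfX (x : ℝ) : ℕ → ℝ
  | 0 => x
  | i + 1 => 1 / ((⌈ncfX x i⌉ : ℝ) - ncfX x i)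

/-- The partial quotients `m_i = ⌈x_i⌉` of the negative continued fraction of `x`. -/
def ncfM (x : ℝ) (i : ℕ) : ℤ := ⌈ncfX x i⌉

/-- The matrices `γ̃_0 = Id`, `γ̃_{i+1} = S T^{-m_i} γ̃_i`. -/
def gamt (x : ℝ) : ℕ → Mat2
  | 0 => 1
  | i + 1 => (MS * Tpow (-(ncfM x i))) * gamt x i

/-- `Γ₁(x) = {γ̃_1, γ̃_2, γ̃_3, …}`. -/
def Gamma1Set (x : ℝ) : Set Mat2 := {M | ∃ i, 1 ≤ i ∧ M = gamt x i}

/-- A binary quadratic polynomial `aX² + bX + c`, encoded as the triple `(a,b,c)`. -/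
abbrev QF := ℤ × ℤ × ℤ

/-- The value of `aX² + bX + c` at a real number `x`. -/
def Qval (q : QF) (x : ℝ) : ℝ := (q.1 : ℝ) * x ^ 2 + (q.2.1 : ℝ) * x + (q.2.2 : ℝ)

/-- The value of `aX² + bX + c` at an integer `m`. -/
def QvalZ (q : QF) (m : ℤ) : ℤ := q.1 * m ^ 2 + q.2.1 * m + q.2.2

/-- The discriminant `b² - 4ac`. -/
def Qdisc (q : QF) : ℤ := q.2.1 ^ 2 - 4 * q.1 * q.2.2

/-- The homogenized value `a r² + b r t + c t²`; for `t ≠ 0` its sign is that of `Q(r/t)`,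
and for `t = 0` that of the leading coefficient, i.e. of `Q(∞)`. -/
def Qhom (q : QF) (r t : ℤ) : ℤ := q.1 * r ^ 2 + q.2.1 * r * t + q.2.2 * t ^ 2

/-- The weight 2 action `(Q|γ)(X) = (tX+u)² Q((rX+s)/(tX+u))` on quadratic polynomials,
for `γ = [[r,s],[t,u]]`. -/
def qslash (M : Mat2) (q : QF) : QF :=
  (Qhom q (M 0 0) (M 1 0),
   2 * q.1 * M 0 0 * M 0 1 + q.2.1 * (M 0 0 * M 1 1 + M 0 1 * M 1 0) + 2 * q.2.2 * M 1 0 * M 1 1,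
   Qhom q (M 0 1) (M 1 1))

/-- The set `𝒬` of integral quadratic polynomials with positive non-square discriminant. -/
def Qset : Set QF := {q | 0 < Qdisc q ∧ ¬ IsSquare (Qdisc q)}

/-- `A` is a `Γ`-equivalence class in `𝒬`, where `Γ = PGL₂(ℤ)`. -/
def IsClassQ (A : Set QF) : Prop :=
  ∃ q₀ ∈ Qset, A = {q ∈ Qset | ∃ M : Mat2, IsUnit M.det ∧ q = qslash M q₀}

/-- `B` is a `Γ₁`-equivalence class in `𝒬`, where `Γ₁ = PSL₂(ℤ)`. -/
def IsClassQ1 (B : Set QF) : Prop :=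
  ∃ q₀ ∈ Qset, B = {q ∈ Qset | ∃ M : Mat2, M.det = 1 ∧ q = qslash M q₀}

/-- `A^Sim = {Q ∈ A : Q(0) < 0 < Q(∞)}`. -/
def QSim (A : Set QF) : Set QF := {q ∈ A | q.2.2 < 0 ∧ 0 < q.1}

/-- `A^Red = {Q ∈ A : Q(∞) > 0, Q(-1) < 0 < Q(0)}`. -/
def QRed (A : Set QF) : Set QF := {q ∈ A | 0 < q.1 ∧ q.1 - q.2.1 + q.2.2 < 0 ∧ 0 < q.2.2}

/-- `A⟨x⟩ = {Q ∈ A : Q(∞) < 0 < Q(x)}`. -/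
def QxSet (A : Set QF) (x : ℝ) : Set QF := {q ∈ A | q.1 < 0 ∧ 0 < Qval q x}

/-- `𝒬_D⟨x⟩`, the set of quadratics of discriminant `D` with `Q(∞) < 0 < Q(x)`. -/
def QDx (D : ℕ) (x : ℝ) : Set QF :=
  {q | Qdisc q = (D : ℤ) ∧ q.1 < 0 ∧ 0 < Qval q x}

/-- The simple forms of discriminant `D`: `a > 0 > c`. -/
def SimpleD (D : ℕ) : Set QF := {q | Qdisc q = (D : ℤ) ∧ 0 < q.1 ∧ q.2.2 < 0}

/-- The reduced forms of discriminant `D`: `a > 0`, `c > 0`, `b > a + c`. -/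
def ReducedD (D : ℕ) : Set QF :=
  {q | Qdisc q = (D : ℤ) ∧ 0 < q.1 ∧ 0 < q.2.2 ∧ q.1 + q.2.2 < q.2.1}

/-- Homogenized evaluation of a polynomial of degree ≤ d: `∑ P_j r^j t^{d-j}`;
for `t ≠ 0` its sign is that of `P(r/t)` (`d` even), and for `t = 0` that of `P(∞)`. -/
def homEval (d : ℕ) (P : Polynomial ℤ) (r t : ℤ) : ℤ :=
  ∑ j ∈ Finset.range (d + 1), P.coeff j * r ^ j * t ^ (d - j)

/-- The weight `d` action `(P|γ)(X) = (tX+u)^d P((rX+s)/(tX+u))` on integral polynomials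
of degree at most `d`, for `γ = [[r,s],[t,u]]`. -/
def pslash (d : ℕ) (M : Mat2) (P : Polynomial ℤ) : Polynomial ℤ :=
  ∑ j ∈ Finset.range (d + 1),
    C (P.coeff j) * (C (M 0 0) * X + C (M 0 1)) ^ j * (C (M 1 0) * X + C (M 1 1)) ^ (d - j)

/-- `P` has exactly two real roots `w ≠ w'`, both irrational. -/
def HasTwoIrratRoots (P : Polynomial ℤ) (w w' : ℝ) : Prop :=
  w ≠ w' ∧ Irrational w ∧ Irrational w' ∧ ∀ y : ℝ, Polynomial.aeval y P = 0 ↔ y = w ∨ y = w'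

/-- `F_d`: integral polynomials of degree ≤ d with exactly two real roots, both irrational. -/
def Fd (d : ℕ) : Set (Polynomial ℤ) :=
  {P | P.natDegree ≤ d ∧ ∃ w w' : ℝ, HasTwoIrratRoots P w w'}

/-- `A` is a `Γ`-equivalence class in `F_d`, where `Γ = PGL₂(ℤ)`. -/
def IsClassF (d : ℕ) (A : Set (Polynomial ℤ)) : Prop :=
  ∃ P₀ ∈ Fd d, A = {P ∈ Fd d | ∃ M : Mat2, IsUnit M.det ∧ P = pslash d M P₀}

/-- `B` is a `Γ₁`-equivalence class in `F_d`, where `Γ₁ = PSL₂(ℤ)`. -/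
def IsClassF1 (d : ℕ) (B : Set (Polynomial ℤ)) : Prop :=
  ∃ P₀ ∈ Fd d, B = {P ∈ Fd d | ∃ M : Mat2, M.det = 1 ∧ P = pslash d M P₀}

/-- `A^Sim = {P ∈ A : P(0) < 0 < P(∞)}`, where `P(∞)` is the coefficient of `X^d`. -/
def PSim (d : ℕ) (A : Set (Polynomial ℤ)) : Set (Polynomial ℤ) :=
  {P ∈ A | P.coeff 0 < 0 ∧ 0 < P.coeff d}

/-- `A^Red = {P ∈ A : P(∞) > 0 and P(-1) < 0 < P(0)}`. -/
def PRed (d : ℕ) (A : Set (Polynomial ℤ)) : Set (Polynomial ℤ) :=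
  {P ∈ A | 0 < P.coeff d ∧ Polynomial.aeval (-1 : ℤ) P < 0 ∧ 0 < P.coeff 0}

/-- `A⟨x⟩ = {P ∈ A : P(∞) < 0 < P(x)}`. -/
def Px (d : ℕ) (A : Set (Polynomial ℤ)) (x : ℝ) : Set (Polynomial ℤ) :=
  {P ∈ A | P.coeff d < 0 ∧ 0 < Polynomial.aeval x P}

/-- The numerators of the convergents, shifted by 2: `pconv x i = p_{i-2}`. -/
def pconv (x : ℝ) : ℕ → ℤ
  | 0 => 0
  | 1 => 1
  | i + 2 => cfN x i * pconv x (i + 1) + pconv x i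

/-- The denominators of the convergents, shifted by 2: `qconv x i = q_{i-2}`. -/
def qconv (x : ℝ) : ℕ → ℤ
  | 0 => 1
  | 1 => 0
  | i + 2 => cfN x i * qconv x (i + 1) + qconv x i

/-- `δ_i = (-1)^i (p_{i-1} - q_{i-1} x)` for `i ≥ 0`. -/
def cfDelta (x : ℝ) (i : ℕ) : ℝ :=
  (-1 : ℝ) ^ i * ((pconv x (i + 1) : ℝ) - (qconv x (i + 1) : ℝ) * x)

/-- The weight `d` action `(P|γ)(X) = (tX+u)^d P((rX+s)/(tX+u))` on complex polynomials
of degree at most `d`, for `γ = [[r,s],[t,u]]` with integer entries. -/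
def cslash (d : ℕ) (M : Mat2) (P : Polynomial ℂ) : Polynomial ℂ :=
  ∑ j ∈ Finset.range (d + 1),
    C (P.coeff j) * (C (M 0 0 : ℂ) * X + C (M 0 1 : ℂ)) ^ j *
      (C (M 1 0 : ℂ) * X + C (M 1 1 : ℂ)) ^ (d - j)

/-- `P^Γ(x) = ∑_{γ ∈ Γ(x)} (P|γ)(x)` for `P` of degree ≤ 2k. -/
def PGam (k : ℕ) (P : Polynomial ℂ) (x : ℝ) : ℂ :=
  ∑' γ : GammaSet x, Polynomial.eval (x : ℂ) (cslash (2 * k) γ.1 P)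

/-- The value `rx + s` of the top row of `γ_i = [[r,s],[t,u]]` at `x`. -/
def gamNum (x : ℝ) (i : ℕ) : ℝ := (gam x i 0 0 : ℝ) * x + (gam x i 0 1 : ℝ)

/-- The value `tx + u` of the bottom row of `γ_i = [[r,s],[t,u]]` at `x`. -/
def gamDen (x : ℝ) (i : ℕ) : ℝ := (gam x i 1 0 : ℝ) * x + (gam x i 1 1 : ℝ)

theorem gamNum_succ (x : ℝ) (i : ℕ) : gamNum x (i + 1) = gamDen x i := by
  simp [gamNum, gamDen, gam, Meps, Tpow, Matrix.mul_apply, Fin.sum_univ_two]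

theorem gamDen_succ (x : ℝ) (i : ℕ) :
    gamDen x (i + 1) = gamNum x i - (⌊cfX x i⌋ : ℝ) * gamDen x i := by
  simp [gamNum, gamDen, gam, Meps, Tpow, Matrix.mul_apply, Fin.sum_univ_two, cfN]
  ring

theorem irrational_cfX {x : ℝ} (hx : Irrational x) (i : ℕ) : Irrational (cfX x i) := by
  induction i with
  | zero => exact hx
  | succ i ih =>
    rw [cfX, one_div]
    exact (ih.sub_intCast _).inv

theorem fract_cfX_pos {x : ℝ} (hx : Irrational x) (i : ℕ) : 0 < Int.fract (cfX x i) :=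
  Int.fract_pos.2 ((irrational_cfX hx i).ne_int _)

theorem one_lt_cfX_succ {x : ℝ} (hx : Irrational x) (i : ℕ) : 1 < cfX x (i + 1) :=
  (one_lt_div (fract_cfX_pos hx i)).2 (Int.fract_lt_one _)

theorem gamNum_eq_cfX_mul {x : ℝ} (hx : Irrational x) (i : ℕ) :
    gamNum x i = cfX x i * gamDen x i := by
  induction i with
  | zero => simp [gamNum, gamDen, gam, cfX]
  | succ i ih =>
    have h : cfX x i - (⌊cfX x i⌋ : ℝ) ≠ 0 := (fract_cfX_pos hx i).ne'
    rw [gamNum_succ, gamDen_succ, ih, ← sub_mul, cfX, ← mul_assoc, one_div_mul_cancel h, one_mul]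

theorem gamDen_succ_eq_fract_mul {x : ℝ} (hx : Irrational x) (i : ℕ) :
    gamDen x (i + 1) = Int.fract (cfX x i) * gamDen x i := by
  rw [gamDen_succ, gamNum_eq_cfX_mul hx, ← sub_mul, Int.fract]

theorem gamDen_zero (x : ℝ) : gamDen x 0 = 1 := by
  simp [gamDen, gam]

theorem gamDen_pos {x : ℝ} (hx : Irrational x) (i : ℕ) : 0 < gamDen x i := by
  induction i with
  | zero => simp [gamDen_zero]
  | succ i ih =>
    rw [gamDen_succ_eq_fract_mul hx]
    exact mul_pos (fract_cfX_pos hx i) ih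

theorem strictAnti_gamDen {x : ℝ} (hx : Irrational x) : StrictAnti (gamDen x) :=
  strictAnti_nat_of_succ_lt fun i => by
    rw [gamDen_succ_eq_fract_mul hx]
    exact mul_lt_of_lt_one_left (gamDen_pos hx i) (Int.fract_lt_one _)

theorem gamDen_le_one {x : ℝ} (hx : Irrational x) (i : ℕ) : gamDen x i ≤ 1 :=
  gamDen_zero x ▸ (strictAnti_gamDen hx).antitone (Nat.zero_le i)

theorem gam_injective {x : ℝ} (hx : Irrational x) : Function.Injective (gam x) := by
  intro i j h
  apply (strictAnti_gamDen hx).injective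
  simp only [gamDen, h]

theorem gamDen_add_two_le {x : ℝ} (hx : Irrational x) (i : ℕ) :
    gamDen x (i + 2) ≤ gamDen x i - gamDen x (i + 1) := by
  rw [gamDen_succ x (i + 1), gamNum_succ]
  have h : (1 : ℝ) ≤ (⌊cfX x (i + 1)⌋ : ℝ) := by
    exact_mod_cast Int.le_floor.2 (by exact_mod_cast (one_lt_cfX_succ hx i).le)
  nlinarith [gamDen_pos hx (i + 1)]

theorem summable_gamDen {x : ℝ} (hx : Irrational x) : Summable (gamDen x) := by
  rw [← summable_nat_add_iff 2]
  refine summable_of_sum_range_le (c := 1) (fun i => (gamDen_pos hx _).le) fun n => ?_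
  calc ∑ i ∈ Finset.range n, gamDen x (i + 2)
      ≤ ∑ i ∈ Finset.range n, (gamDen x i - gamDen x (i + 1)) :=
        Finset.sum_le_sum fun i _ => gamDen_add_two_le hx i
    _ = 1 - gamDen x n := by rw [Finset.sum_range_sub', gamDen_zero]
    _ ≤ 1 := by linarith [gamDen_pos hx n]

theorem eval_cslash (d : ℕ) (M : Mat2) (P : Polynomial ℂ) (z : ℂ) :
    eval z (cslash d M P) = ∑ j ∈ Finset.range (d + 1),
      P.coeff j * ((M 0 0 : ℂ) * z + M 0 1) ^ j * ((M 1 0 : ℂ) * z + M 1 1) ^ (d - j) := by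
  simp [cslash, eval_finsetSum]

theorem eval_cslash_gam_succ (d : ℕ) (P : Polynomial ℂ) (x : ℝ) (i : ℕ) :
    eval (x : ℂ) (cslash d (gam x (i + 1)) P) = ∑ j ∈ Finset.range (d + 1),
      P.coeff j * (gamDen x i : ℂ) ^ j * (gamDen x (i + 1) : ℂ) ^ (d - j) := by
  rw [eval_cslash, ← gamNum_succ]
  simp [gamNum, gamDen]

theorem eval_cslash_one {d : ℕ} {P : Polynomial ℂ} (hP : P.natDegree ≤ d) (z : ℂ) :
    eval z (cslash d 1 P) = eval z P := by
  rw [eval_cslash, eval_eq_sum_range' (Nat.lt_succ_of_le hP)]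
  simp

theorem pow_mul_eval_cslash_mul_Meps (d : ℕ) (M : Mat2) (P : Polynomial ℂ) {z : ℂ} (hz : z ≠ 0) :
    z ^ d * eval (1 / z) (cslash d (M * Meps) P) = eval z (cslash d M P) := by
  rw [eval_cslash, eval_cslash, Finset.mul_sum]
  refine Finset.sum_congr rfl fun j hj => ?_
  have hd : z ^ d = z ^ j * z ^ (d - j) := by
    rw [← pow_add, Nat.add_sub_cancel' (Finset.mem_range_succ_iff.1 hj)]
  have hrow (a b : ℂ) : a * z + b = z * (b * (1 / z) + a) := by
    field_simp
    ring
  simp only [Meps, Matrix.mul_apply, Fin.sum_univ_two, hrow, mul_pow, hd]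
  simp
  ring

theorem summable_eval_cslash_gam {d : ℕ} (hd : 1 ≤ d) (P : Polynomial ℂ) {x : ℝ}
    (hx : Irrational x) : Summable fun i => eval (x : ℂ) (cslash d (gam x i) P) := by
  rw [← summable_nat_add_iff 1]
  refine Summable.of_norm_bounded
    ((summable_gamDen hx).mul_left (∑ j ∈ Finset.range (d + 1), ‖P.coeff j‖)) fun i => ?_
  rw [eval_cslash_gam_succ, Finset.sum_mul]
  refine norm_sum_le_of_le _ fun j hj => ?_
  have h0 := (gamDen_pos hx i).le
  have h1 := (gamDen_pos hx (i + 1)).le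
  rw [norm_mul, norm_mul, norm_pow, norm_pow, Complex.norm_of_nonneg h0, Complex.norm_of_nonneg h1,
    mul_assoc]
  refine mul_le_mul_of_nonneg_left ?_ (norm_nonneg _)
  calc gamDen x i ^ j * gamDen x (i + 1) ^ (d - j)
      ≤ gamDen x i ^ j * gamDen x i ^ (d - j) := by
        gcongr
        exact (strictAnti_gamDen hx).antitone i.le_succ
    _ = gamDen x i ^ d := by
        rw [← pow_add, Nat.add_sub_cancel' (Finset.mem_range_succ_iff.1 hj)]
    _ ≤ gamDen x i := pow_le_of_le_one h0 (gamDen_le_one hx i) (by lia)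

theorem PGam_eq_tsum (k : ℕ) (P : Polynomial ℂ) {x : ℝ} (hx : Irrational x) :
    PGam k P x = ∑' i, eval (x : ℂ) (cslash (2 * k) (gam x (i + 1)) P) := by
  have hrange : GammaSet x = Set.range fun i => gam x (i + 1) := by
    ext M
    constructor
    · rintro ⟨i, hi, rfl⟩
      exact ⟨i - 1, by simp [Nat.sub_add_cancel hi]⟩
    · rintro ⟨i, rfl⟩
      exact ⟨i + 1, by simp, rfl⟩
  have hinj : Function.Injective fun i => gam x (i + 1) :=
    (gam_injective hx).comp (add_left_injective 1)
  rw [PGam, hrange]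
  exact tsum_range (fun M => eval (x : ℂ) (cslash (2 * k) M P)) hinj

theorem floor_one_div_of_one_lt {x : ℝ} (hx1 : 1 < x) : ⌊1 / x⌋ = 0 := by
  rw [Int.floor_eq_zero_iff]
  exact ⟨by positivity, (div_lt_one (by linarith)).2 hx1⟩

theorem cfX_one_div_succ {x : ℝ} (hx1 : 1 < x) (i : ℕ) : cfX (1 / x) (i + 1) = cfX x i := by
  induction i with
  | zero => simp only [cfX, floor_one_div_of_one_lt hx1, Int.cast_zero, sub_zero, one_div_one_div]
  | succ i ih => rw [cfX, ih, cfX]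

theorem gam_one_div_succ {x : ℝ} (hx1 : 1 < x) (i : ℕ) :
    gam (1 / x) (i + 1) = gam x i * Meps := by
  induction i with
  | zero =>
    simp only [gam, cfN, cfX, floor_one_div_of_one_lt hx1]
    simp [Tpow, Meps]
  | succ i ih => rw [gam, ih, gam, cfN, cfN, cfX_one_div_succ hx1, ← Matrix.mul_assoc (Meps * Tpow _)]

theorem PGam_sub_of_one_lt {k : ℕ} (hk : 1 ≤ k) {P : Polynomial ℂ} (hP : P.natDegree ≤ 2 * k)
    {x : ℝ} (hx : Irrational x) (hx1 : 1 < x) :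
    PGam k P x - (x : ℂ) ^ (2 * k) * PGam k P (1 / x) = -eval (x : ℂ) P := by
  have hxz : (x : ℂ) ≠ 0 := by exact_mod_cast (by linarith : x ≠ 0)
  have hx' : Irrational (1 / x) := by simpa using hx.inv
  have h : (x : ℂ) ^ (2 * k) * PGam k P (1 / x) =
      ∑' i, eval (x : ℂ) (cslash (2 * k) (gam x i) P) := by
    rw [PGam_eq_tsum k P hx', ← tsum_mul_left]
    congr 1 with i
    rw [gam_one_div_succ hx1, Complex.ofReal_div, Complex.ofReal_one,
      pow_mul_eval_cslash_mul_Meps _ _ _ hxz]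
  rw [h, (summable_eval_cslash_gam (by lia) P hx).tsum_eq_zero_add, PGam_eq_tsum k P hx, gam,
    eval_cslash_one hP]
  ring

/-- **Theorem 6(iii).** For `k ≥ 1`, `P ∈ ℂ[X]` of degree ≤ 2k and
irrational `x > 0`: if `x > 1` then `P^Γ(x) - x^{2k} P^Γ(1/x) = -P(x)`, and if
`0 < x < 1` then `P^Γ(x) - x^{2k} P^Γ(1/x) = x^{2k} P(1/x)`; that is,
`(P^Γ|(1-ε))(x) = χ_{(0,1)}(x)·(P|(1+ε))(x) - P(x)`. -/
theorem stmt14 (k : ℕ) (hk : 1 ≤ k) (P : Polynomial ℂ) (hP : P.natDegree ≤ 2 * k)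
    (x : ℝ) (hx : Irrational x) (hx0 : 0 < x) :
    (1 < x →
      PGam k P x - (x : ℂ) ^ (2 * k) * PGam k P (1 / x) =
        -Polynomial.eval (x : ℂ) P) ∧
    (x < 1 →
      PGam k P x - (x : ℂ) ^ (2 * k) * PGam k P (1 / x) =
        (x : ℂ) ^ (2 * k) * Polynomial.eval ((1 / x : ℝ) : ℂ) P) := by
  refine ⟨PGam_sub_of_one_lt hk hP hx, fun hx1 => ?_⟩
  have hxz : (x : ℂ) ≠ 0 := by exact_mod_cast hx0.ne'
  have h := PGam_sub_of_one_lt hk hP (x := 1 / x) (by simpa using hx.inv)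
    ((one_lt_div hx0).2 hx1)
  rw [one_div_one_div] at h
  have hpow : (x : ℂ) ^ (2 * k) * ((1 / x : ℝ) : ℂ) ^ (2 * k) = 1 := by
    rw [← mul_pow, Complex.ofReal_div, Complex.ofReal_one, mul_one_div_cancel hxz, one_pow]
  linear_combination -(x : ℂ) ^ (2 * k) * h - PGam k P x * hpow
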